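/- Let μ ∈ P_cost^AC(X) and let φ : Y → ℝ be bounded and continuous. Then inf_{ν∈P_cost(Y)} [∫_Y φ dν + K_c(μ,ν)] = ∫_X (−φ)^c dμ, where (−φ)^c(x) = inf_{y∈Y} (c(x,y) + φ(y)). Furthermore, the infimum is attained by ν̄ = T_{(−φ)^c}#μ. -/

import Mathlib

open MeasureTheory Filter Set Topology
open scoped ENNReal BigOperators RealInnerProductSpace

noncomputable section

abbrev Euc (d : ℕ) : Type := EuclideanSpace ℝ (Fin d)

/-- `π` is a coupling of `μ` and `ν`. -/
def IsCoupling {d : ℕ} (π : Measure (Euc d × Euc d)) (μ ν : Measure (Euc d)) : Prop :=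
  π.map Prod.fst = μ ∧ π.map Prod.snd = ν

/-- The optimal transport cost between `μ` and `ν` for the cost `c`. -/
def transportCost {d : ℕ} (c : Euc d → Euc d → ℝ) (μ ν : Measure (Euc d)) : ℝ :=
  (⨅ π : {π : Measure (Euc d × Euc d) // IsCoupling π μ ν},
      ∫⁻ p, ENNReal.ofReal (c p.1 p.2) ∂(π.1)).toReal

/-- Probability measures supported on `S` with finite cost integral `∫ c₀`. -/
def memPcost {d : ℕ} (c₀ : Euc d → ℝ) (S : Set (Euc d)) (μ : Measure (Euc d)) : Prop :=
  IsProbabilityMeasure μ ∧ μ Sᶜ = 0 ∧ ∫⁻ x, ENNReal.ofReal (c₀ x) ∂μ < ⊤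

/-- The signed barycenter (primal) functional. -/
def barycenterFun {d m : ℕ} (c : Euc d → Euc d → ℝ) (a : Fin m → ℝ)
    (μs : Fin m → Measure (Euc d)) (ν : Measure (Euc d)) : ℝ :=
  ∑ i, a i * transportCost c (μs i) ν

/-- The c-transform of `f : Y → ℝ`, a function on `X`. -/
def ctransOnY {d : ℕ} (c : Euc d → Euc d → ℝ) (Y : Set (Euc d)) (f : Euc d → ℝ)
    (x : Euc d) : ℝ :=
  ⨅ y : Y, (c x y - f y)

/-- The c-transform of `g : X → ℝ`, a function on `Y`. -/
def ctransOnX {d : ℕ} (c : Euc d → Euc d → ℝ) (X : Set (Euc d)) (g : Euc d → ℝ)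
    (y : Euc d) : ℝ :=
  ⨅ x : X, (c x y - g x)

/-- `f` is c-concave as a function on `Y`. -/
def CConcaveOnY {d : ℕ} (c : Euc d → Euc d → ℝ) (X Y : Set (Euc d)) (f : Euc d → ℝ) : Prop :=
  ∃ g : Euc d → ℝ, ∀ y ∈ Y, f y = ctransOnX c X g y

/-- `g` is c-concave as a function on `X`. -/
def CConcaveOnX {d : ℕ} (c : Euc d → Euc d → ℝ) (X Y : Set (Euc d)) (g : Euc d → ℝ) : Prop :=
  ∃ f : Euc d → ℝ, ∀ x ∈ X, g x = ctransOnY c Y f x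

/-- Assumptions (A1)–(A3) on the cost. -/
structure CostAssumptions (d : ℕ) (X Y : Set (Euc d)) (c : Euc d → Euc d → ℝ)
    (x0 y0 : Euc d) : Prop where
  openX : IsOpen X
  openY : IsOpen Y
  nonneg : ∀ x ∈ X, ∀ y ∈ Y, 0 ≤ c x y
  smooth : ContDiffOn ℝ 2 (fun p : Euc d × Euc d => c p.1 p.2) (X ×ˢ Y)
  twistX : ∀ x ∈ X, Set.InjOn (fun y => gradient (fun x' => c x' y) x) Y
  twistY : ∀ y ∈ Y, Set.InjOn (fun x => gradient (fun y' => c x y') y) X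
  compactX : ∀ (b : ℝ), ∀ y' ∈ Y, IsCompact {x ∈ X | c x y' ≤ b}
  compactY : ∀ (b : ℝ), ∀ x' ∈ X, IsCompact {y ∈ Y | c x' y ≤ b}
  x0mem : x0 ∈ X
  y0mem : y0 ∈ Y
  growth : ∀ ε : ℝ, 0 < ε → ∃ B : ℝ, 0 < B ∧ ∀ x ∈ X, ∀ y ∈ Y,
      ((1 - ε) * c x0 y - B * c x y0 ≤ c x y ∧ c x y ≤ (1 + ε) * c x0 y + B * c x y0) ∧
      ((1 - ε) * c x y0 - B * c x0 y ≤ c x y ∧ c x y ≤ (1 + ε) * c x y0 + B * c x0 y)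

/-- Weak convergence of a sequence of measures (in duality with bounded continuous functions). -/
def WeakLimit {d : ℕ} (νs : ℕ → Measure (Euc d)) (ν : Measure (Euc d)) : Prop :=
  ∀ g : BoundedContinuousFunction (Euc d) ℝ,
    Tendsto (fun n => ∫ y, g y ∂(νs n)) atTop (𝓝 (∫ y, g y ∂ν))


namespace CostAssumptions

variable {d : ℕ} {X Y : Set (Euc d)} {c : Euc d → Euc d → ℝ} {x0 y0 : Euc d} {φ : Euc d → ℝ}
  {M : ℝ}

lemma continuousOn_right (hc : CostAssumptions d X Y c x0 y0) {x : Euc d} (hx : x ∈ X) :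
    ContinuousOn (fun y => c x y) Y :=
  hc.smooth.continuousOn.comp (f := fun y => (x, y)) (by fun_prop) fun _ hy => ⟨hx, hy⟩

lemma continuousOn_left (hc : CostAssumptions d X Y c x0 y0) {y : Euc d} (hy : y ∈ Y) :
    ContinuousOn (fun x => c x y) X :=
  hc.smooth.continuousOn.comp (f := fun x => (x, y)) (by fun_prop) fun _ hx => ⟨hx, hy⟩

lemma hasFDerivAt_left (hc : CostAssumptions d X Y c x0 y0) {x y : Euc d} (hx : x ∈ X)
    (hy : y ∈ Y) :
    HasFDerivAt (fun x' => c x' y) ((fderiv ℝ (fun p : Euc d × Euc d => c p.1 p.2) (x, y)).comp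
      (ContinuousLinearMap.inl ℝ (Euc d) (Euc d))) x := by
  have h : DifferentiableAt ℝ (fun p : Euc d × Euc d => c p.1 p.2) (x, y) :=
    (hc.smooth.differentiableOn (by norm_num)).differentiableAt
      ((hc.openX.prod hc.openY).mem_nhds ⟨hx, hy⟩)
  exact HasFDerivAt.comp (f := fun x' => (x', y)) x h.hasFDerivAt (hasFDerivAt_prodMk_left x y)

lemma exists_cost_left_le (hc : CostAssumptions d X Y c x0 y0) :
    ∃ B : ℝ, 0 < B ∧ ∀ x ∈ X, ∀ y ∈ Y, c x0 y ≤ 2 * (c x y + B * c x y0) := by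
  obtain ⟨B, hB, h⟩ := hc.growth (1 / 2) (by norm_num)
  refine ⟨B, hB, fun x hx y hy => ?_⟩
  have := (h x hx y hy).1.1
  linarith

lemma bddBelow_range (hc : CostAssumptions d X Y c x0 y0) (hφb : ∀ y, |φ y| ≤ M) {x : Euc d}
    (hx : x ∈ X) : BddBelow (range fun y : Y => c x y + φ y) := by
  refine ⟨-M, ?_⟩
  rintro _ ⟨y, rfl⟩
  have := hc.nonneg x hx y y.2
  have := abs_le.1 (hφb y)
  dsimp only
  linarith

lemma iInf_le_add (hc : CostAssumptions d X Y c x0 y0) (hφb : ∀ y, |φ y| ≤ M) {x y : Euc d}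
    (hx : x ∈ X) (hy : y ∈ Y) : (⨅ y : Y, (c x y + φ y)) ≤ c x y + φ y :=
  ciInf_le (hc.bddBelow_range hφb hx) (⟨y, hy⟩ : Y)

lemma neg_le_iInf (hc : CostAssumptions d X Y c x0 y0) (hφb : ∀ y, |φ y| ≤ M) {x : Euc d}
    (hx : x ∈ X) : -M ≤ ⨅ y : Y, (c x y + φ y) := by
  have : Nonempty Y := ⟨⟨y0, hc.y0mem⟩⟩
  refine le_ciInf fun y => ?_
  have := hc.nonneg x hx y y.2
  have := abs_le.1 (hφb y)
  linarith

/-- The infimum defining the `c`-transform of `-φ` is attained. -/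
lemma exists_iInf_eq (hc : CostAssumptions d X Y c x0 y0) (hφc : Continuous φ)
    (hφb : ∀ y, |φ y| ≤ M) {x : Euc d} (hx : x ∈ X) :
    ∃ y ∈ Y, (⨅ y : Y, (c x y + φ y)) = c x y + φ y := by
  have hM : 0 ≤ M := (abs_nonneg _).trans (hφb y0)
  have hy0 : y0 ∈ {y ∈ Y | c x y ≤ c x y0 + 2 * M} := ⟨hc.y0mem, by linarith⟩
  obtain ⟨y, hy, hmin⟩ := (hc.compactY (c x y0 + 2 * M) x hx).exists_isMinOn ⟨y0, hy0⟩
    (((hc.continuousOn_right hx).mono fun _ h => h.1).add hφc.continuousOn)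
  have : Nonempty Y := ⟨⟨y0, hc.y0mem⟩⟩
  refine ⟨y, hy.1, le_antisymm (hc.iInf_le_add hφb hx hy.1) (le_ciInf fun z => ?_)⟩
  by_cases hz : c x z ≤ c x y0 + 2 * M
  · exact hmin (show (z : Euc d) ∈ {y ∈ Y | c x y ≤ c x y0 + 2 * M} from ⟨z.2, hz⟩)
  · have h0 : c x y + φ y ≤ c x y0 + φ y0 := hmin hy0
    have h1 := abs_le.1 (hφb y0)
    have h2 := abs_le.1 (hφb z)
    linarith

/-- The `c`-transform of `-φ` is locally Lipschitz on `X`. -/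
lemma exists_lipschitzOnWith_iInf (hc : CostAssumptions d X Y c x0 y0) (hφc : Continuous φ)
    (hφb : ∀ y, |φ y| ≤ M) {x : Euc d} (hx : x ∈ X) :
    ∃ r > 0, ∃ L, LipschitzOnWith L (fun x' => ⨅ y : Y, (c x' y + φ y)) (Metric.ball x r) := by
  obtain ⟨r, hr, hrX⟩ := Metric.nhds_basis_closedBall.mem_iff.1 (hc.openX.mem_nhds hx)
  have hK : IsCompact (Metric.closedBall x r) := isCompact_closedBall x r
  obtain ⟨C, hC⟩ := hK.bddAbove_image ((hc.continuousOn_left hc.y0mem).mono hrX)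
  obtain ⟨B, hB, hgrow⟩ := hc.exists_cost_left_le
  set b : ℝ := 2 * ((1 + B) * C + 2 * M) with hb
  have hfd := hc.smooth.continuousOn_fderiv_of_isOpen (hc.openX.prod hc.openY) (by norm_num)
  obtain ⟨L, hL⟩ := (hK.prod (hc.compactY b x0 hc.x0mem)).exists_bound_of_continuousOn
    (hfd.mono (prod_mono hrX fun _ h => h.1))
  refine ⟨r, hr, _, LipschitzOnWith.of_le_add_mul' L fun u hu v hv => ?_⟩
  have hu' := Metric.ball_subset_closedBall hu
  have hv' := Metric.ball_subset_closedBall hv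
  obtain ⟨y, hy, hvy⟩ := hc.exists_iInf_eq hφc hφb (hrX hv')
  have hyb : y ∈ {y ∈ Y | c x0 y ≤ b} := by
    refine ⟨hy, ?_⟩
    have h1 := hgrow v (hrX hv') y hy
    have h2 : c v y0 ≤ C := hC (mem_image_of_mem _ hv')
    have h3 := hc.iInf_le_add hφb (hrX hv') hc.y0mem
    have h4 := abs_le.1 (hφb y0)
    have h5 := abs_le.1 (hφb y)
    have h6 : B * c v y0 ≤ B * C := mul_le_mul_of_nonneg_left h2 hB.le
    rw [hb]
    linarith
  have hLip : ‖c u y - c v y‖ ≤ L * ‖u - v‖ := by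
    refine (convex_closedBall x r).norm_image_sub_le_of_norm_hasFDerivWithin_le
      (f := fun x' => c x' y)
      (fun z hz => (hc.hasFDerivAt_left (hrX hz) hy).hasFDerivWithinAt) (fun z hz => ?_) hv' hu'
    grw [ContinuousLinearMap.opNorm_comp_le, ContinuousLinearMap.norm_inl_le_one, mul_one]
    exact hL (z, y) ⟨hz, hyb⟩
  have h1 := hc.iInf_le_add hφb (hrX hu') hy
  have h2 := (le_abs_self _).trans hLip
  rw [dist_eq_norm]
  linarith

lemma continuousOn_iInf (hc : CostAssumptions d X Y c x0 y0) (hφc : Continuous φ)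
    (hφb : ∀ y, |φ y| ≤ M) : ContinuousOn (fun x => ⨅ y : Y, (c x y + φ y)) X := by
  intro x hx
  obtain ⟨r, hr, L, hL⟩ := hc.exists_lipschitzOnWith_iInf hφc hφb hx
  exact (hL.continuousOn.continuousAt (Metric.ball_mem_nhds x hr)).continuousWithinAt

lemma ae_differentiableAt_iInf (hc : CostAssumptions d X Y c x0 y0) (hφc : Continuous φ)
    (hφb : ∀ y, |φ y| ≤ M) :
    ∀ᵐ x, x ∈ X → DifferentiableAt ℝ (fun x => ⨅ y : Y, (c x y + φ y)) x := by
  rw [ae_iff]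
  refine measure_null_of_locally_null _ fun x hx => ?_
  simp only [mem_ofPred_eq, Classical.not_imp] at hx
  obtain ⟨r, hr, L, hL⟩ := hc.exists_lipschitzOnWith_iInf hφc hφb hx.1
  refine ⟨_, inter_mem_nhdsWithin _ (Metric.ball_mem_nhds x hr), ?_⟩
  refine measure_mono_null ?_ (ae_iff.1 (hL.ae_differentiableWithinAt_of_mem (μ := volume)))
  rintro z ⟨hz, hzr⟩
  simp only [mem_ofPred_eq, Classical.not_imp] at hz ⊢
  exact ⟨hzr, fun h => hz.2 (h.differentiableAt (Metric.isOpen_ball.mem_nhds hzr))⟩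

/-- At a point of differentiability, the gradient condition identifies the minimizer. -/
lemma iInf_eq_of_gradient_eq (hc : CostAssumptions d X Y c x0 y0) (hφc : Continuous φ)
    (hφb : ∀ y, |φ y| ≤ M) {x t : Euc d} (hx : x ∈ X) (ht : t ∈ Y)
    (hdiff : DifferentiableAt ℝ (fun x => ⨅ y : Y, (c x y + φ y)) x)
    (hgrad : gradient (fun x' => c x' t) x = gradient (fun x' => ⨅ y : Y, (c x' y + φ y)) x) :
    (⨅ y : Y, (c x y + φ y)) = c x t + φ t := by
  obtain ⟨y, hy, hxy⟩ := hc.exists_iInf_eq hφc hφb hx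
  have hmin : IsLocalMin (fun x' => c x' y - ⨅ y : Y, (c x' y + φ y)) x := by
    filter_upwards [hc.openX.mem_nhds hx] with z hz
    have := hc.iInf_le_add hφb hz hy
    linarith
  have hzero := hmin.fderiv_eq_zero
  rw [fderiv_fun_sub (hc.hasFDerivAt_left hx hy).differentiableAt hdiff, sub_eq_zero] at hzero
  have hyt : y = t := hc.twistX x hx hy ht <| by
    dsimp only
    rw [hgrad, gradient, gradient, hzero]
  rw [hxy, hyt]

lemma integrable_cost_left (hc : CostAssumptions d X Y c x0 y0) {μ : Measure (Euc d)}
    (hμ : memPcost (fun x => c x y0) X μ) : Integrable (fun x => c x y0) μ := by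
  have hX : ∀ᵐ x ∂μ, x ∈ X := hμ.2.1
  refine ⟨?_, (hasFiniteIntegral_iff_ofReal ?_).2 hμ.2.2⟩
  · rw [← Measure.restrict_eq_self_of_ae_mem hX]
    exact (hc.continuousOn_left hc.y0mem).aestronglyMeasurable hc.openX.measurableSet
  · filter_upwards [hX] with x hx using hc.nonneg x hx y0 hc.y0mem

lemma integrable_iInf (hc : CostAssumptions d X Y c x0 y0) (hφc : Continuous φ)
    (hφb : ∀ y, |φ y| ≤ M) {μ : Measure (Euc d)} (hμ : memPcost (fun x => c x y0) X μ) :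
    Integrable (fun x => ⨅ y : Y, (c x y + φ y)) μ := by
  have hX : ∀ᵐ x ∂μ, x ∈ X := hμ.2.1
  have := hμ.1
  refine ((hc.integrable_cost_left hμ).add (integrable_const M)).mono' ?_ ?_
  · rw [← Measure.restrict_eq_self_of_ae_mem hX]
    exact (hc.continuousOn_iInf hφc hφb).aestronglyMeasurable hc.openX.measurableSet
  · filter_upwards [hX] with x hx
    have h1 := hc.iInf_le_add hφb hx hc.y0mem
    have h2 := hc.neg_le_iInf hφb hx
    have h3 := abs_le.1 (hφb y0)
    have h4 := hc.nonneg x hx y0 hc.y0mem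
    rw [Real.norm_eq_abs, abs_le, Pi.add_apply]
    constructor <;> linarith

/-- Weak duality against a single coupling. -/
lemma ofReal_integral_sub_le_lintegral (hc : CostAssumptions d X Y c x0 y0) (hφc : Continuous φ)
    (hφb : ∀ y, |φ y| ≤ M) {μ ν : Measure (Euc d)} (hμ : memPcost (fun x => c x y0) X μ)
    (hν : memPcost (fun y => c x0 y) Y ν) {π : Measure (Euc d × Euc d)}
    (hπ : IsCoupling π μ ν) :
    ENNReal.ofReal ((∫ x, (⨅ y : Y, (c x y + φ y)) ∂μ) - ∫ y, φ y ∂ν) ≤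
      ∫⁻ p, ENNReal.ofReal (c p.1 p.2) ∂π := by
  obtain ⟨hfst, hsnd⟩ := hπ
  have := hμ.1
  have := hν.1
  have hX : ∀ᵐ p ∂π, p.1 ∈ X := by
    have : ∀ᵐ x ∂(π.map Prod.fst), x ∈ X := by rw [hfst]; exact hμ.2.1
    exact ae_of_ae_map measurable_fst.aemeasurable this
  have hY : ∀ᵐ p ∂π, p.2 ∈ Y := by
    have : ∀ᵐ y ∂(π.map Prod.snd), y ∈ Y := by rw [hsnd]; exact hν.2.1
    exact ae_of_ae_map measurable_snd.aemeasurable this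
  have hnonneg : 0 ≤ᵐ[π] fun p => c p.1 p.2 := by
    filter_upwards [hX, hY] with p h1 h2 using hc.nonneg _ h1 _ h2
  have hmeas : AEStronglyMeasurable (fun p : Euc d × Euc d => c p.1 p.2) π := by
    rw [← Measure.restrict_eq_self_of_ae_mem (s := X ×ˢ Y) (hX.and hY)]
    exact hc.smooth.continuousOn.aestronglyMeasurable (hc.openX.prod hc.openY).measurableSet
  have hint := hc.integrable_iInf hφc hφb hμ
  have hφint : Integrable φ ν :=
    (integrable_const M).mono' hφc.aestronglyMeasurable (ae_of_all _ hφb)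
  rcases eq_or_ne (∫⁻ p, ENNReal.ofReal (c p.1 p.2) ∂π) ⊤ with htop | htop
  · simp [htop]
  have hcint : Integrable (fun p : Euc d × Euc d => c p.1 p.2) π :=
    ⟨hmeas, (hasFiniteIntegral_iff_ofReal hnonneg).2 htop.lt_top⟩
  rw [← ofReal_integral_eq_lintegral_ofReal hcint hnonneg]
  refine ENNReal.ofReal_le_ofReal ?_
  rw [← hfst] at hint ⊢
  rw [← hsnd] at hφint ⊢
  rw [integral_map measurable_fst.aemeasurable hint.1,
    integral_map measurable_snd.aemeasurable hφint.1]
  have hint' : Integrable (fun p : Euc d × Euc d => ⨅ y : Y, (c p.1 y + φ y)) π :=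
    hint.comp_measurable measurable_fst
  have hφint' : Integrable (fun p : Euc d × Euc d => φ p.2) π :=
    hφint.comp_measurable measurable_snd
  rw [← integral_sub hint' hφint']
  refine integral_mono_ae (hint'.sub hφint') hcint ?_
  filter_upwards [hX, hY] with p h1 h2
  have := hc.iInf_le_add hφb h1 h2
  linarith

/-- Independent coupling has finite cost, so the optimal transport cost is finite. -/
lemma iInf_lintegral_ne_top (hc : CostAssumptions d X Y c x0 y0) {μ ν : Measure (Euc d)}
    (hμ : memPcost (fun x => c x y0) X μ) (hν : memPcost (fun y => c x0 y) Y ν) :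
    (⨅ π : {π : Measure (Euc d × Euc d) // IsCoupling π μ ν},
      ∫⁻ p, ENNReal.ofReal (c p.1 p.2) ∂(π.1)) ≠ ⊤ := by
  obtain ⟨hμP, hμX, hμfin⟩ := hμ
  obtain ⟨hνP, hνY, hνfin⟩ := hν
  have hX : ∀ᵐ x ∂μ, x ∈ X := hμX
  have hY : ∀ᵐ y ∂ν, y ∈ Y := hνY
  obtain ⟨B, hB, hgrow⟩ := hc.growth 1 one_pos
  have hcoup : IsCoupling (μ.prod ν) μ ν := by
    constructor <;> simp [Measure.map_fst_prod, Measure.map_snd_prod]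
  refine ((iInf_le _ (⟨_, hcoup⟩ : {π // IsCoupling π μ ν})).trans_lt ?_).ne
  calc ∫⁻ p, ENNReal.ofReal (c p.1 p.2) ∂(μ.prod ν)
      ≤ ∫⁻ x, ∫⁻ y, ENNReal.ofReal (c x y) ∂ν ∂μ := lintegral_prod_le _
    _ ≤ ∫⁻ x, (2 * ∫⁻ y, ENNReal.ofReal (c x0 y) ∂ν) +
          ENNReal.ofReal B * ENNReal.ofReal (c x y0) ∂μ := by
        refine lintegral_mono_ae ?_
        filter_upwards [hX] with x hx
        calc ∫⁻ y, ENNReal.ofReal (c x y) ∂ν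
            ≤ ∫⁻ y, 2 * ENNReal.ofReal (c x0 y) +
                ENNReal.ofReal B * ENNReal.ofReal (c x y0) ∂ν := by
              refine lintegral_mono_ae ?_
              filter_upwards [hY] with y hy
              have h1 := (hgrow x hx y hy).1.2
              rw [← ENNReal.ofReal_mul hB.le, ← ENNReal.ofReal_ofNat 2,
                ← ENNReal.ofReal_mul (by norm_num), ← ENNReal.ofReal_add]
              · exact ENNReal.ofReal_le_ofReal (by linarith)
              · exact mul_nonneg (by norm_num) (hc.nonneg _ hc.x0mem _ hy)
              · exact mul_nonneg hB.le (hc.nonneg _ hx _ hc.y0mem)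
          _ = _ := by
              rw [lintegral_add_right _ measurable_const, lintegral_const_mul' _ _ ENNReal.ofNat_ne_top]
              simp
    _ < ⊤ := by
        rw [lintegral_add_left measurable_const, lintegral_const_mul' _ _ ENNReal.ofReal_ne_top]
        simp only [lintegral_const, measure_univ, mul_one]
        exact ENNReal.add_lt_top.2 ⟨ENNReal.mul_lt_top (by simp) hνfin,
          ENNReal.mul_lt_top (by simp) hμfin⟩

lemma integral_iInf_le (hc : CostAssumptions d X Y c x0 y0) (hφc : Continuous φ)
    (hφb : ∀ y, |φ y| ≤ M) {μ ν : Measure (Euc d)} (hμ : memPcost (fun x => c x y0) X μ)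
    (hν : memPcost (fun y => c x0 y) Y ν) :
    ∫ x, (⨅ y : Y, (c x y + φ y)) ∂μ ≤ (∫ y, φ y ∂ν) + transportCost c μ ν := by
  have h := (ENNReal.ofReal_le_iff_le_toReal (hc.iInf_lintegral_ne_top hμ hν)).1
    (le_iInf fun π => hc.ofReal_integral_sub_le_lintegral hφc hφb hμ hν π.2)
  rw [transportCost]
  linarith

/-- The image of `μ` under a measurable selection of minimizers has finite cost. -/
lemma memPcost_map (hc : CostAssumptions d X Y c x0 y0) (hφb : ∀ y, |φ y| ≤ M)
    {μ : Measure (Euc d)} (hμ : memPcost (fun x => c x y0) X μ) {T : Euc d → Euc d}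
    (hTmeas : AEMeasurable T μ) (hTY : ∀ᵐ x ∂μ, T x ∈ Y)
    (hmin : ∀ᵐ x ∂μ, (⨅ y : Y, (c x y + φ y)) = c x (T x) + φ (T x)) :
    memPcost (fun y => c x0 y) Y (μ.map T) := by
  have := hμ.1
  have hX : ∀ᵐ x ∂μ, x ∈ X := hμ.2.1
  obtain ⟨B, hB, hgrow⟩ := hc.exists_cost_left_le
  refine ⟨Measure.isProbabilityMeasure_map hTmeas,
    (ae_map_iff hTmeas hc.openY.measurableSet).2 hTY, (lintegral_map_le _ _).trans_lt ?_⟩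
  have hint : Integrable (fun x => 2 * (1 + B) * c x y0 + 4 * M) μ :=
    ((hc.integrable_cost_left hμ).const_mul _).add (integrable_const _)
  refine lt_of_le_of_lt (lintegral_mono_ae ?_) hint.lintegral_lt_top
  filter_upwards [hX, hTY, hmin] with x hx hTx hxmin
  refine ENNReal.ofReal_le_ofReal ?_
  have h1 := hgrow x hx (T x) hTx
  have h2 := hc.iInf_le_add hφb hx hc.y0mem
  have h3 := abs_le.1 (hφb y0)
  have h4 := abs_le.1 (hφb (T x))
  linarith

/-- The transport cost to the image of `μ` under a selection of minimizers is at most the cost of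
that selection. -/
lemma transportCost_map_le (hc : CostAssumptions d X Y c x0 y0) (hφc : Continuous φ)
    (hφb : ∀ y, |φ y| ≤ M) {μ : Measure (Euc d)} (hμ : memPcost (fun x => c x y0) X μ)
    {T : Euc d → Euc d} (hTmeas : AEMeasurable T μ) (hTY : ∀ᵐ x ∂μ, T x ∈ Y)
    (hmin : ∀ᵐ x ∂μ, (⨅ y : Y, (c x y + φ y)) = c x (T x) + φ (T x)) :
    (∫ y, φ y ∂(μ.map T)) + transportCost c μ (μ.map T) ≤
      ∫ x, (⨅ y : Y, (c x y + φ y)) ∂μ := by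
  have := hμ.1
  have hX : ∀ᵐ x ∂μ, x ∈ X := hμ.2.1
  have hpair : AEMeasurable (fun x => (x, T x)) μ := aemeasurable_id.prodMk hTmeas
  have hcoup : IsCoupling (μ.map fun x => (x, T x)) μ (μ.map T) := by
    constructor
    · rw [AEMeasurable.map_map_of_aemeasurable measurable_fst.aemeasurable hpair]
      exact Measure.map_id
    · rw [AEMeasurable.map_map_of_aemeasurable measurable_snd.aemeasurable hpair]
      rfl
  have hint := hc.integrable_iInf hφc hφb hμ
  have hφint : Integrable (fun x => φ (T x)) μ :=
    (integrable_const M).mono' (hφc.measurable.comp_aemeasurable hTmeas).aestronglyMeasurable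
      (ae_of_all _ fun x => hφb (T x))
  have hnonneg : 0 ≤ᵐ[μ] fun x => (⨅ y : Y, (c x y + φ y)) - φ (T x) := by
    filter_upwards [hX, hTY, hmin] with x hx hTx hxmin
    have := hc.nonneg x hx _ hTx
    simp only [Pi.zero_apply]
    linarith
  have hle : (⨅ π : {π : Measure (Euc d × Euc d) // IsCoupling π μ (μ.map T)},
      ∫⁻ p, ENNReal.ofReal (c p.1 p.2) ∂(π.1)) ≤
      ENNReal.ofReal (∫ x, ((⨅ y : Y, (c x y + φ y)) - φ (T x)) ∂μ) := by
    refine (iInf_le _ (⟨_, hcoup⟩ : {π // IsCoupling π μ (μ.map T)})).trans ?_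
    rw [ofReal_integral_eq_lintegral_ofReal
      (f := fun x => (⨅ y : Y, (c x y + φ y)) - φ (T x)) (hint.sub hφint) hnonneg]
    refine (lintegral_map_le _ _).trans (lintegral_mono_ae ?_)
    filter_upwards [hmin] with x hxmin
    exact ENNReal.ofReal_le_ofReal (by linarith)
  have hcost := ENNReal.toReal_le_of_le_ofReal (integral_nonneg_of_ae hnonneg) hle
  rw [integral_sub hint hφint] at hcost
  rw [integral_map hTmeas hφc.aestronglyMeasurable, transportCost]
  linarith

end CostAssumptions

/-- For `μ ∈ P_cost^AC(X)` and bounded continuous `φ : Y → ℝ`,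
`inf_{ν ∈ P_cost(Y)} [∫ φ dν + K_c(μ,ν)] = ∫ (−φ)^c dμ`, and the infimum is attained by
`ν̄ = T_{(−φ)^c}#μ`, where `(−φ)^c(x) = inf_{y∈Y} (c(x,y) + φ(y))`. -/
theorem dual_of_linear_plus_transport {d : ℕ} (hd : 1 ≤ d)
    (X Y : Set (Euc d)) (c : Euc d → Euc d → ℝ) (x0 y0 : Euc d)
    (hc : CostAssumptions d X Y c x0 y0)
    (μ : Measure (Euc d)) (hμ : memPcost (fun x => c x y0) X μ) (hμac : μ ≪ volume)
    (φ : Euc d → ℝ) (hφc : Continuous φ) (hφb : ∃ M : ℝ, ∀ y, |φ y| ≤ M)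
    -- `T` is the optimal map `T_{(−φ)^c}` determined `μ`-a.e. by `∇_x c(x, T(x)) = ∇(−φ)^c(x)`
    (T : Euc d → Euc d) (hTmeas : AEMeasurable T μ) (hTY : ∀ᵐ x ∂μ, T x ∈ Y)
    (hT : ∀ᵐ x ∂μ, gradient (fun x' => c x' (T x)) x =
        gradient (fun x' => ⨅ y : Y, (c x' y + φ y)) x) :
    (∀ ν : Measure (Euc d), memPcost (fun y => c x0 y) Y ν →
        ∫ x, (⨅ y : Y, (c x y + φ y)) ∂μ ≤ (∫ y, φ y ∂ν) + transportCost c μ ν) ∧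
    memPcost (fun y => c x0 y) Y (μ.map T) ∧
    (∫ y, φ y ∂(μ.map T)) + transportCost c μ (μ.map T) =
      ∫ x, (⨅ y : Y, (c x y + φ y)) ∂μ := by
  obtain ⟨M, hφb⟩ := hφb
  have hX : ∀ᵐ x ∂μ, x ∈ X := hμ.2.1
  have hmin : ∀ᵐ x ∂μ, (⨅ y : Y, (c x y + φ y)) = c x (T x) + φ (T x) := by
    filter_upwards [hX, hTY, hT, hμac.ae_le (hc.ae_differentiableAt_iInf hφc hφb)]
      with x hx hTx hgrad hdiff
    exact hc.iInf_eq_of_gradient_eq hφc hφb hx hTx (hdiff hx) hgrad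
  have hν := hc.memPcost_map hφb hμ hTmeas hTY hmin
  exact ⟨fun ν hν => hc.integral_iInf_le hφc hφb hμ hν, hν,
    le_antisymm (hc.transportCost_map_le hφc hφb hμ hTmeas hTY hmin)
      (hc.integral_iInf_le hφc hφb hμ hν)⟩

end
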